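/- arXiv:math/0009133 — 2 statements merged into one kernel-verified Lean document; each statement's English description precedes it below -/
import Mathlib

section
/- Let g ≥ 1 and let (k₁,n₁),…,(k_g,n_g) be pairs of coprime positive integers with n_ν > 1 for all ν and k₁ > n₁. Then the set of rational numbers {(i/n_ν + j/w_ν + r)/n'_ν : 1 ≤ ν ≤ g, i, j, r ∈ ℤ, 0 < i < n_ν, 0 < j < w_ν, 0 ≤ r < n'_ν, i/n_ν + j/w_ν < 1} is nonempty and its minimum equals (k₁ + n₁)/(k₁·n'₀). (This is the formula α₁ = (k₁+n₁)/(k₁n₁⋯n_g) for the smallest exponent of an irreducible plane curve singularity.) -/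
open Finset

/-- `n'_ν = n_{ν+1} ⋯ n_g`. -/
def nprod (g : ℕ) (n : ℕ → ℕ) (ν : ℕ) : ℕ :=
  ∏ μ ∈ Finset.Icc (ν + 1) g, n μ

/-- Peeling off the first factor of `nprod`. -/
theorem nprod_eq_mul_nprod_succ {g : ℕ} (n : ℕ → ℕ) {ν : ℕ} (h : ν + 1 ≤ g) :
    nprod g n ν = n (ν + 1) * nprod g n (ν + 1) := by
  unfold nprod
  rw [← Finset.insert_Icc_add_one_left_eq_Icc h, Finset.prod_insert (by simp)]

theorem nprod_pos {g : ℕ} {n : ℕ → ℕ} (hn : ∀ ν, 1 ≤ ν → ν ≤ g → 1 < n ν) (ν : ℕ) :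
    0 < nprod g n ν := by
  refine Finset.prod_pos fun μ hμ => ?_
  rw [Finset.mem_Icc] at hμ
  exact (hn μ (by omega) hμ.2).trans' one_pos

theorem nprod_antitone {g : ℕ} {n : ℕ → ℕ} (hn : ∀ ν, 1 ≤ ν → ν ≤ g → 1 < n ν) :
    Antitone (nprod g n) := by
  refine antitone_nat_of_succ_le fun ν => ?_
  rcases le_or_gt (ν + 1) g with h | h
  · rw [nprod_eq_mul_nprod_succ n h]
    exact Nat.le_mul_of_pos_left _ ((hn _ (by omega) h).trans' one_pos)
  · unfold nprod
    rw [Finset.Icc_eq_empty (by omega), Finset.Icc_eq_empty (by omega)]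

/-- **(5.2.1).** For an irreducible plane curve singularity with Puiseux pairs
`(k_ν, n_ν)` (coprime, `n_ν > 1`, `k₁ > n₁`, `g ≥ 1`), with `w₁ = k₁`,
`w_ν = w_{ν−1} n_{ν−1} n_ν + k_ν`, `n'_ν = n_{ν+1} ⋯ n_g`, the set of exponents
less than `1`, namely `{(i/n_ν + j/w_ν + r)/n'_ν}` over `1 ≤ ν ≤ g`, `0 < i < n_ν`,
`0 < j < w_ν`, `0 ≤ r < n'_ν`, `i/n_ν + j/w_ν < 1`, is nonempty with minimum
`α₁ = (k₁ + n₁)/(k₁ n₁ ⋯ n_g)`. -/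
theorem smallest_exponent (g : ℕ) (hg : 1 ≤ g) (k n w : ℕ → ℕ)
    (hpairs : ∀ ν, 1 ≤ ν → ν ≤ g → Nat.Coprime (k ν) (n ν) ∧ 0 < k ν ∧ 1 < n ν)
    (hk1 : n 1 < k 1)
    (hw1 : w 1 = k 1)
    (hw : ∀ ν, 1 < ν → ν ≤ g → w ν = w (ν - 1) * n (ν - 1) * n ν + k ν) :
    IsLeast
      {α : ℚ | ∃ ν : ℕ, ∃ i j r : ℤ, 1 ≤ ν ∧ ν ≤ g ∧
        0 < i ∧ i < (n ν : ℤ) ∧ 0 < j ∧ j < (w ν : ℤ) ∧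
        0 ≤ r ∧ r < (nprod g n ν : ℤ) ∧
        (i : ℚ) / (n ν) + (j : ℚ) / (w ν) < 1 ∧
        α = ((i : ℚ) / (n ν) + (j : ℚ) / (w ν) + (r : ℚ)) / (nprod g n ν)}
      (((k 1 : ℚ) + (n 1 : ℚ)) / ((k 1 : ℚ) * (nprod g n 0 : ℚ))) := by
  have hn : ∀ ν, 1 ≤ ν → ν ≤ g → 1 < n ν := fun ν h₁ h₂ => (hpairs ν h₁ h₂).2.2
  have hP : ∀ ν, (0 : ℚ) < nprod g n ν := fun ν => by exact_mod_cast nprod_pos hn ν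
  have hn1 : 2 ≤ n 1 := hn 1 le_rfl hg
  have hn1q : (2 : ℚ) ≤ n 1 := by exact_mod_cast hn1
  have hk1q : (n 1 : ℚ) + 1 ≤ k 1 := by exact_mod_cast hk1
  have hk0 : (0 : ℚ) < k 1 := by linarith
  have hn0 : (0 : ℚ) < n 1 := by linarith
  have hlt : (1 : ℚ) / n 1 + 1 / k 1 < 1 := by
    rw [div_add_div _ _ hn0.ne' hk0.ne', div_lt_one (by positivity)]
    nlinarith
  have hmin : ((k 1 : ℚ) + n 1) / (k 1 * nprod g n 0)
      = (1 / n 1 + 1 / k 1) / nprod g n 1 := by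
    have hP1 := (hP 1).ne'
    rw [nprod_eq_mul_nprod_succ n (ν := 0) hg]
    push_cast
    field_simp
  rw [hmin]
  constructor
  · refine ⟨1, 1, 1, 0, le_rfl, hg, one_pos, by omega, one_pos, by omega, le_rfl, ?_, ?_, ?_⟩
    · exact_mod_cast nprod_pos hn 1
    · simpa [hw1] using hlt
    · simp [hw1]
  · rintro α ⟨ν, i, j, r, hν, hνg, hi, -, hj, -, hr, -, -, rfl⟩
    have hi' : (1 : ℚ) ≤ i := by exact_mod_cast hi
    have hj' : (1 : ℚ) ≤ j := by exact_mod_cast hj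
    have hr' : (0 : ℚ) ≤ r := by exact_mod_cast hr
    have hnν : (0 : ℚ) < n ν := by exact_mod_cast (hn ν hν hνg).trans' one_pos
    have hPν := hP ν
    rcases hν.eq_or_lt with rfl | hν1
    · rw [hw1]
      have h₁ : (1 : ℚ) / n 1 ≤ i / n 1 := by gcongr
      have h₂ : (1 : ℚ) / k 1 ≤ j / k 1 := by gcongr
      exact div_le_div_of_nonneg_right (by linarith) hPν.le
    · obtain ⟨μ, rfl⟩ : ∃ μ, ν = μ + 1 := ⟨ν - 1, by omega⟩
      have hle : (n (μ + 1) : ℚ) * nprod g n (μ + 1) ≤ nprod g n 1 := by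
        have := nprod_antitone hn (show 1 ≤ μ by omega)
        rw [nprod_eq_mul_nprod_succ n hνg] at this
        exact_mod_cast this
      have h₁ : (1 : ℚ) / n (μ + 1) ≤ i / n (μ + 1) := by gcongr
      have h₂ : (0 : ℚ) ≤ j / w (μ + 1) := by positivity
      calc ((1 : ℚ) / n 1 + 1 / k 1) / nprod g n 1
          ≤ 1 / nprod g n 1 := by gcongr
        _ ≤ 1 / (n (μ + 1) * nprod g n (μ + 1)) := by gcongr
        _ = 1 / n (μ + 1) / nprod g n (μ + 1) := by rw [div_div]
        _ ≤ (i / n (μ + 1) + j / w (μ + 1) + r) / nprod g n (μ + 1) := by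
          gcongr
          linarith
end

section
/- Let g ≥ 2 and let (k₁,n₁),…,(k_g,n_g) be pairs of coprime positive integers with n_ν > 1 for all ν and k₁ > n₁. Then ∑_{ν=1}^{g} (n_ν − 1)/(w_ν·n'_ν) < (n₁ − 1)/k₁. -/
open Finset

theorem nprod_self (g : ℕ) (n : ℕ → ℕ) : nprod g n g = 1 := by
  simp [nprod]

theorem nprod_succ {g ν : ℕ} (n : ℕ → ℕ) (h : ν ≤ g) :
    nprod (g + 1) n ν = nprod g n ν * n (g + 1) :=
  Finset.prod_Icc_succ_top (by omega) _

/-- The weighted sum up to `g + 1` is the one up to `g` divided by `n (g + 1)`, plus one term. -/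
theorem sum_div_nprod_succ (g : ℕ) (n w : ℕ → ℕ) :
    ∑ ν ∈ Finset.Icc 1 (g + 1), ((n ν : ℚ) - 1) / ((w ν : ℚ) * (nprod (g + 1) n ν : ℚ)) =
      (∑ ν ∈ Finset.Icc 1 g, ((n ν : ℚ) - 1) / ((w ν : ℚ) * (nprod g n ν : ℚ))) / n (g + 1)
        + ((n (g + 1) : ℚ) - 1) / w (g + 1) := by
  rw [Finset.sum_Icc_succ_top (by omega), nprod_self, Finset.sum_div]
  congr 1
  · refine Finset.sum_congr rfl fun ν hν => ?_
    rw [nprod_succ n (Finset.mem_Icc.mp hν).2, div_div]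
    push_cast
    rw [mul_assoc]
  · simp

/-- A convex-combination estimate: `S / N + (N - 1) / W < A` as soon as `S ≤ A` and
`N / W < A`. -/
theorem div_add_sub_one_div_lt {S A N W : ℚ} (hN : 1 < N) (hS : S ≤ A) (hW : N / W < A) :
    S / N + (N - 1) / W < A := by
  have hN0 : 0 < N := by linarith
  have h1 : S / N ≤ A / N := by gcongr
  have h2 : (N - 1) / W = (N - 1) / N * (N / W) := by field_simp
  have h3 : (N - 1) / N * (N / W) < (N - 1) / N * A :=
    mul_lt_mul_of_pos_left hW (div_pos (by linarith) hN0)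
  have h4 : A / N + (N - 1) / N * A = A := by field_simp; ring
  linarith

/-- With `g ≥ 2`, coprime pairs `(k_ν, n_ν)`, `n_ν > 1`, `k₁ > n₁`, `w₁ = k₁`,
`w_ν = w_{ν−1} n_{ν−1} n_ν + k_ν`, `n'_ν = n_{ν+1} ⋯ n_g`:
`∑_{ν=1}^{g} (n_ν − 1)/(w_ν n'_ν) < (n₁ − 1)/k₁`. -/
theorem sum_lt (g : ℕ) (hg : 2 ≤ g) (k n w : ℕ → ℕ)
    (hpairs : ∀ ν, 1 ≤ ν → ν ≤ g → Nat.Coprime (k ν) (n ν) ∧ 0 < k ν ∧ 1 < n ν)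
    (hk1 : n 1 < k 1)
    (hw1 : w 1 = k 1)
    (hw : ∀ ν, 1 < ν → ν ≤ g → w ν = w (ν - 1) * n (ν - 1) * n ν + k ν) :
    ∑ ν ∈ Finset.Icc 1 g, ((n ν : ℚ) - 1) / ((w ν : ℚ) * (nprod g n ν : ℚ))
      < ((n 1 : ℚ) - 1) / (k 1 : ℚ) := by
  have hle : ∀ m, 1 ≤ m → m ≤ g → k 1 ≤ w m := by
    intro m hm
    induction m, hm using Nat.le_induction with
    | base => intro _; exact hw1.ge
    | succ m hm ih =>
      intro hmg
      have hn := (hpairs m hm (by omega)).2.2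
      have hn' := (hpairs (m + 1) (by omega) hmg).2.2
      rw [hw (m + 1) (by omega) hmg, Nat.add_sub_cancel]
      calc k 1 ≤ w m := ih (by omega)
        _ ≤ w m * n m := Nat.le_mul_of_pos_right _ (by omega)
        _ ≤ w m * n m * n (m + 1) := Nat.le_mul_of_pos_right _ (by omega)
        _ ≤ _ := Nat.le_add_right _ _
  obtain ⟨-, hk0, hn1⟩ := hpairs 1 le_rfl (by omega)
  have hstep : ∀ m, 1 ≤ m → m + 1 ≤ g →
      ∑ ν ∈ Finset.Icc 1 m, ((n ν : ℚ) - 1) / ((w ν : ℚ) * (nprod m n ν : ℚ))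
        ≤ ((n 1 : ℚ) - 1) / (k 1 : ℚ) →
      ∑ ν ∈ Finset.Icc 1 (m + 1), ((n ν : ℚ) - 1) / ((w ν : ℚ) * (nprod (m + 1) n ν : ℚ))
        < ((n 1 : ℚ) - 1) / (k 1 : ℚ) := by
    intro m hm hmg hS
    obtain ⟨-, hk', hn'⟩ := hpairs (m + 1) (by omega) hmg
    have hn := (hpairs m hm (by omega)).2.2
    rw [sum_div_nprod_succ]
    refine div_add_sub_one_div_lt (by exact_mod_cast hn') hS ?_
    have hlt : k 1 * n (m + 1) < w (m + 1) := by
      rw [hw (m + 1) (by omega) hmg, Nat.add_sub_cancel]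
      have : k 1 * n (m + 1) ≤ w m * n m * n (m + 1) :=
        Nat.mul_le_mul_right _
          ((hle m hm (by omega)).trans (Nat.le_mul_of_pos_right _ (by omega)))
      omega
    have hltQ : (k 1 : ℚ) * n (m + 1) < w (m + 1) := by exact_mod_cast hlt
    have hkQ : (0 : ℚ) < k 1 := by exact_mod_cast hk0
    have hnQ : (2 : ℚ) ≤ n 1 := by exact_mod_cast hn1
    have hwQ : (0 : ℚ) < w (m + 1) := lt_of_le_of_lt (by positivity) hltQ
    rw [div_lt_div_iff₀ hwQ hkQ]
    nlinarith
  have hbound : ∀ m, 1 ≤ m → m ≤ g →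
      ∑ ν ∈ Finset.Icc 1 m, ((n ν : ℚ) - 1) / ((w ν : ℚ) * (nprod m n ν : ℚ))
        ≤ ((n 1 : ℚ) - 1) / (k 1 : ℚ) := by
    intro m hm
    induction m, hm using Nat.le_induction with
    | base => intro _; simp [nprod_self, hw1]
    | succ m hm ih => exact fun hmg => (hstep m hm hmg (ih (by omega))).le
  obtain ⟨m, rfl⟩ : ∃ m, g = m + 1 := ⟨g - 1, by omega⟩
  exact hstep m (by omega) le_rfl (hbound m (by omega) (by omega))
end
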